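/- For δ > 0, β > 0 and every binary qubit POVM in conical coordinates (w, λ, θ, φ), the extracted information never exceeds the information loss: F_β ≤ D^{(Δ)}. Moreover, equality holds if and only if λ = 0 (the uninformative measurement) or sinθ = 0 (the measurement is semiclassical, i.e. its POVM elements commute with ρ_β). -/

import Mathlib

open Matrix ComplexOrder Real

noncomputable def pauliX : Matrix (Fin 2) (Fin 2) ℂ := !![0, 1; 1, 0]
noncomputable def pauliY : Matrix (Fin 2) (Fin 2) ℂ := !![0, -Complex.I; Complex.I, 0]
noncomputable def pauliZ : Matrix (Fin 2) (Fin 2) ℂ := !![1, 0; 0, -1]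

/-- The thermal qubit state `ρ_β = diag(e^{−βδ/2}, e^{βδ/2})/(2 cosh(βδ/2))`. -/
noncomputable def rhoTherm (δ β : ℝ) : Matrix (Fin 2) (Fin 2) ℂ :=
  ((2 * Real.cosh (β * δ / 2) : ℝ)⁻¹ : ℂ) •
    !![Complex.exp (-(β * δ / 2)), 0; 0, Complex.exp (β * δ / 2)]

/-- The POVM element `Π₀` of a binary qubit POVM in conical coordinates. -/
noncomputable def povm0 (w l θ φ : ℝ) : Matrix (Fin 2) (Fin 2) ℂ :=
  (w : ℂ) • ((1 : Matrix (Fin 2) (Fin 2) ℂ)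
    + ((l * Real.sin θ * Real.cos φ : ℝ) : ℂ) • pauliX
    + ((l * Real.sin θ * Real.sin φ : ℝ) : ℂ) • pauliY
    + ((l * Real.cos θ : ℝ) : ℂ) • pauliZ)

/-- The POVM element `Π₁ = I₂ − Π₀`. -/
noncomputable def povm1 (w l θ φ : ℝ) : Matrix (Fin 2) (Fin 2) ℂ :=
  1 - povm0 w l θ φ

/-- The outcome probability `p₀(β) = tr(ρ_β Π₀)`. -/
noncomputable def prob0 (δ β w l θ φ : ℝ) : ℝ :=
  ((rhoTherm δ β * povm0 w l θ φ).trace).re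

/-- The Fisher information of the measurement, `F_β = (dp₀/dβ)²/(p₀ p₁)`. -/
noncomputable def fisherInfo (δ β w l θ φ : ℝ) : ℝ :=
  (deriv (fun b => prob0 δ b w l θ φ) β) ^ 2 /
    (prob0 δ β w l θ φ * (1 - prob0 δ β w l θ φ))
/-- The quantum Fisher information `F^Q = δ²/(2 + 2cosh(βδ))` of the thermal qubit model. -/
noncomputable def qfiModel (δ β : ℝ) : ℝ := δ ^ 2 / (2 + 2 * Real.cosh (β * δ))

/-- The QFI `Q₀` of the post-measurement state for outcome 0. -/
noncomputable def qfiPost0 (δ β l θ : ℝ) : ℝ :=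
  δ ^ 2 * (1 - l ^ 2) * Real.exp (β * δ) /
    ((1 + l * Real.cos θ) + Real.exp (β * δ) * (1 - l * Real.cos θ)) ^ 2

/-- The QFI `Q₁` of the post-measurement state for outcome 1. -/
noncomputable def qfiPost1 (δ β w l θ : ℝ) : ℝ :=
  δ ^ 2 * ((1 - w) ^ 2 - l ^ 2 * w ^ 2) * Real.exp (β * δ) /
    (1 - w * (1 + l * Real.cos θ) + Real.exp (β * δ) * (1 - w * (1 - l * Real.cos θ))) ^ 2

/-- The Δ-disturbance (information loss) `D^{(Δ)} = F^Q − p₀Q₀ − p₁Q₁`. -/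
noncomputable def deltaDist (δ β w l θ φ : ℝ) : ℝ :=
  qfiModel δ β - prob0 δ β w l θ φ * qfiPost0 δ β l θ -
    (1 - prob0 δ β w l θ φ) * qfiPost1 δ β w l θ

/-- The outcome probability in terms of `exp (β * δ)`. -/
lemma prob0_eq (δ β w l θ φ : ℝ) :
    prob0 δ β w l θ φ =
      w * ((1 + l * Real.cos θ) + Real.exp (β * δ) * (1 - l * Real.cos θ)) /
        (1 + Real.exp (β * δ)) := by
  have h : prob0 δ β w l θ φ = (2 * Real.cosh (β * δ / 2))⁻¹ *
      (Real.exp (-(β * δ / 2)) * (w * (1 + l * Real.cos θ)) +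
        Real.exp (β * δ / 2) * (w * (1 - l * Real.cos θ))) := by
    have hc : prob0 δ β w l θ φ = (((2 * Real.cosh (β * δ / 2))⁻¹ *
        (Real.exp (-(β * δ / 2)) * (w * (1 + l * Real.cos θ)) +
          Real.exp (β * δ / 2) * (w * (1 - l * Real.cos θ))) : ℝ) : ℂ).re := by
      unfold prob0
      congr 1
      simp [rhoTherm, povm0, pauliX, pauliY, pauliZ, Matrix.trace_fin_two,
        Matrix.one_fin_two]
      ring
    rw [hc, Complex.ofReal_re]
  have hE : Real.exp (β * δ) = Real.exp (β * δ / 2) ^ 2 := by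
    rw [← Real.exp_nat_mul]; congr 1; push_cast; ring
  have hx := Real.exp_pos (β * δ / 2)
  rw [h, hE, Real.cosh_eq, Real.exp_neg]
  field_simp
  ring

lemma hasDerivAt_prob0 (δ β w l θ φ : ℝ) :
    HasDerivAt (fun b => prob0 δ b w l θ φ)
      (-(2 * w * (l * Real.cos θ) * δ * Real.exp (β * δ)) / (1 + Real.exp (β * δ)) ^ 2) β := by
  have hE : HasDerivAt (fun b : ℝ => Real.exp (b * δ)) (Real.exp (β * δ) * δ) β := by
    simpa using ((hasDerivAt_id β).mul_const δ).exp
  have h0 : 1 + Real.exp (β * δ) ≠ 0 := by positivity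
  simp only [prob0_eq]
  refine ((((hE.mul_const (1 - l * Real.cos θ)).const_add (1 + l * Real.cos θ)).const_mul w).div
    (hE.const_add 1) h0).congr_deriv ?_
  congr 1
  ring

lemma qfiModel_eq (δ β : ℝ) :
    qfiModel δ β = δ ^ 2 * Real.exp (β * δ) / (1 + Real.exp (β * δ)) ^ 2 := by
  have hE := Real.exp_pos (β * δ)
  rw [qfiModel, Real.cosh_eq, Real.exp_neg]
  have h1 : 2 + 2 * ((Real.exp (β * δ) + (Real.exp (β * δ))⁻¹) / 2) =
      (1 + Real.exp (β * δ)) ^ 2 / Real.exp (β * δ) := by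
    field_simp
    ring
  rw [h1, div_div_eq_mul_div]

/-- The gap between information loss and extracted information, in closed form. -/
lemma deltaDist_sub_fisherInfo {δ β w l θ φ : ℝ}
    (hA : (1 + l * Real.cos θ) + Real.exp (β * δ) * (1 - l * Real.cos θ) ≠ 0)
    (hB : 1 - w * (1 + l * Real.cos θ) + Real.exp (β * δ) * (1 - w * (1 - l * Real.cos θ)) ≠ 0) :
    deltaDist δ β w l θ φ - fisherInfo δ β w l θ φ =
      δ ^ 2 * Real.exp (β * δ) * w * (l * Real.sin θ) ^ 2 /
        (((1 + l * Real.cos θ) + Real.exp (β * δ) * (1 - l * Real.cos θ)) *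
          (1 - w * (1 + l * Real.cos θ) +
            Real.exp (β * δ) * (1 - w * (1 - l * Real.cos θ)))) := by
  have hS : 1 + Real.exp (β * δ) ≠ 0 := by positivity
  have hp1 : 1 - prob0 δ β w l θ φ =
      (1 - w * (1 + l * Real.cos θ) + Real.exp (β * δ) * (1 - w * (1 - l * Real.cos θ))) /
        (1 + Real.exp (β * δ)) := by
    rw [prob0_eq]
    field_simp
    ring
  rw [deltaDist, fisherInfo, (hasDerivAt_prob0 δ β w l θ φ).deriv, hp1, prob0_eq, qfiModel_eq,
    qfiPost0, qfiPost1, mul_pow l, Real.sin_sq]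
  generalize Real.exp (β * δ) = E at *
  generalize Real.cos θ = c at *
  obtain ⟨A, hAe⟩ : ∃ A, A = (1 + l * c) + E * (1 - l * c) := ⟨_, rfl⟩
  obtain ⟨B, hBe⟩ : ∃ B, B = 1 - w * (1 + l * c) + E * (1 - w * (1 - l * c)) := ⟨_, rfl⟩
  rw [← hAe] at hA ⊢
  rw [← hBe] at hB ⊢
  field_simp
  subst hAe hBe
  ring

/-- The extracted information never exceeds the information loss, `F_β ≤ D^{(Δ)}`,
with equality iff `λ = 0` (uninformative) or `sin θ = 0` (semiclassical). -/
theorem stmt11 (δ β : ℝ) (hδ : 0 < δ) (hβ : 0 < β) :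
    ∀ w l θ φ : ℝ, 0 < w → w ≤ 1 / 2 → 0 ≤ l → l ≤ 1 →
      0 ≤ θ → θ ≤ π → 0 ≤ φ → φ < 2 * π →
      fisherInfo δ β w l θ φ ≤ deltaDist δ β w l θ φ ∧
      (fisherInfo δ β w l θ φ = deltaDist δ β w l θ φ ↔ (l = 0 ∨ Real.sin θ = 0)) := by
  intro w l θ φ hw hw2 hl hl1 _ _ _ _
  have hE := Real.exp_pos (β * δ)
  have ha : |l * Real.cos θ| ≤ 1 := by
    rw [abs_mul]
    exact mul_le_one₀ (by rwa [abs_of_nonneg hl]) (abs_nonneg _) (Real.abs_cos_le_one θ)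
  obtain ⟨ha1, ha2⟩ := abs_le.mp ha
  have hA : 0 < (1 + l * Real.cos θ) + Real.exp (β * δ) * (1 - l * Real.cos θ) := by
    rcases ha1.eq_or_lt with h | h
    · rw [← h]; linarith
    · nlinarith [mul_nonneg hE.le (sub_nonneg.mpr ha2)]
  have hB : 0 < 1 - w * (1 + l * Real.cos θ) +
      Real.exp (β * δ) * (1 - w * (1 - l * Real.cos θ)) := by
    have h1 : 0 ≤ 1 - w * (1 + l * Real.cos θ) := by nlinarith
    have h2 : 0 ≤ 1 - w * (1 - l * Real.cos θ) := by nlinarith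
    rcases h1.eq_or_lt with h | h
    · have h3 : 0 < 1 - w * (1 - l * Real.cos θ) := by nlinarith
      rw [← h]
      positivity
    · positivity
  have key := deltaDist_sub_fisherInfo (φ := φ) hA.ne' hB.ne'
  refine ⟨sub_nonneg.mp (key ▸ by positivity), ?_⟩
  rw [eq_comm, ← sub_eq_zero, key]
  simp [hδ.ne', hw.ne', hA.ne', hB.ne']
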